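/- Let q be a prime with q ≡ 1 (mod 6) or q = 3, and let s be an integer with q ∣ Φ₆(s), where Φ₆(x) = x² − x + 1. Define n₆(x) = q·x² + (2s − 1)·x + Φ₆(s)/q, p₆(x) = Φ₄(q·x + s) with Φ₄(x) = x² + 1, and t₆(x) = 1 + q·x + s. Then for every integer x: (i) q·n₆(x) = p₆(x) + 1 − t₆(x); (ii) q·n₆(x) divides Φ₆(p₆(x)); (iii) t₆(x)² − 4·p₆(x) ≤ 0. Moreover n₆ and p₆ are irreducible as polynomials over ℤ. -/

import Mathlib

open Polynomial

/-- The 4th cyclotomic polynomial, evaluated at an integer. -/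
def Phi4 (x : ℤ) : ℤ := x ^ 2 + 1

/-- The 6th cyclotomic polynomial, evaluated at an integer. -/
def Phi6 (x : ℤ) : ℤ := x ^ 2 - x + 1

/-- A primitive integer quadratic with negative discriminant is irreducible. -/
theorem irreducible_quadratic_of_discrim_neg {a b c : ℤ} (hdisc : discrim a b c < 0)
    (hprim : ∀ d : ℤ, d ∣ a → d ∣ b → d ∣ c → IsUnit d) :
    Irreducible (C a * X ^ 2 + C b * X + C c) := by
  have ha : a ≠ 0 := by
    rintro rfl
    simp only [discrim] at hdisc
    nlinarith [sq_nonneg b]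
  have hdeg := natDegree_quadratic (b := b) (c := c) ha
  have key (g h : ℤ[X]) (hfac : C a * X ^ 2 + C b * X + C c = g * h)
      (hg : g.natDegree = 0) : IsUnit g := by
    rw [eq_C_of_natDegree_eq_zero hg] at hfac ⊢
    have hcoeff := (C_dvd_iff_dvd_coeff _ _).1 (Dvd.intro _ hfac.symm)
    exact (hprim _ (by simpa [coeff_C, -eq_intCast] using hcoeff 2)
      (by simpa [coeff_C, -eq_intCast] using hcoeff 1)
      (by simpa [coeff_C, -eq_intCast] using hcoeff 0)).map C
  have hnu : ¬IsUnit (C a * X ^ 2 + C b * X + C c) := fun hu => by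
    have := natDegree_eq_zero_of_isUnit hu
    omega
  refine ⟨hnu, fun g h hfac => ?_⟩
  have hne : g * h ≠ 0 := by
    rw [← hfac]
    intro h0
    rw [h0, natDegree_zero] at hdeg
    omega
  have hsum : g.natDegree + h.natDegree = 2 := by
    rw [← natDegree_mul (left_ne_zero_of_mul hne) (right_ne_zero_of_mul hne), ← hfac, hdeg]
  by_cases hg : g.natDegree = 0
  · exact .inl (key g h hfac hg)
  by_cases hh : h.natDegree = 0
  · exact .inr (key h g (hfac.trans (mul_comm g h)) hh)
  exfalso
  obtain ⟨u, v, rfl⟩ := exists_eq_X_add_C_of_natDegree_le_one (p := g) (by omega)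
  obtain ⟨w, z, rfl⟩ := exists_eq_X_add_C_of_natDegree_le_one (p := h) (by omega)
  have hexp : (C u * X + C v) * (C w * X + C z) =
      C (u * w) * X ^ 2 + C (u * z + v * w) * X + C (v * z) := by
    simp only [C_mul, C_add]
    ring
  rw [hexp] at hfac
  have h2 : a = u * w := by
    simpa [coeff_C, -eq_intCast, -map_mul, -map_add] using congrArg (coeff · 2) hfac
  have h1 : b = u * z + v * w := by
    simpa [coeff_C, -eq_intCast, -map_mul, -map_add] using congrArg (coeff · 1) hfac
  have h0 : c = v * z := by
    simpa [coeff_C, -eq_intCast, -map_mul, -map_add] using congrArg (coeff · 0) hfac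
  rw [discrim, h0, h1, h2] at hdisc
  nlinarith [sq_nonneg (u * z - v * w)]

theorem mnt_family_k6_case_phi6 (q : ℤ) (hq : Prime q) (hmod : q % 6 = 1 ∨ q = 3)
    (s : ℤ) (hdvd : q ∣ Phi6 s)
    (n6 : ℤ → ℤ) (hn6 : ∀ x, n6 x = q * x ^ 2 + (2 * s - 1) * x + Phi6 s / q)
    (p6 : ℤ → ℤ) (hp6 : ∀ x, p6 x = Phi4 (q * x + s))
    (t6 : ℤ → ℤ) (ht6 : ∀ x, t6 x = 1 + q * x + s) :
    (∀ x : ℤ, q * n6 x = p6 x + 1 - t6 x) ∧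
    (∀ x : ℤ, q * n6 x ∣ Phi6 (p6 x)) ∧
    (∀ x : ℤ, t6 x ^ 2 - 4 * p6 x ≤ 0) ∧
    Irreducible (C q * X ^ 2 + C (2 * s - 1) * X + C (Phi6 s / q)) ∧
    Irreducible ((C q * X + C s) ^ 2 + 1) := by
  have hquot : q * (Phi6 s / q) = s ^ 2 - s + 1 := Int.mul_ediv_cancel' hdvd
  have horder (x : ℤ) : q * n6 x = p6 x + 1 - t6 x := by
    rw [hn6, hp6, ht6, Phi4]
    linear_combination hquot
  refine ⟨horder, fun x => ?_, fun x => ?_, ?_, ?_⟩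
  · refine ⟨(q * x + s) ^ 2 + (q * x + s) + 1, ?_⟩
    rw [horder, hp6, ht6, Phi4, Phi6]
    ring
  · rw [hp6, ht6, Phi4]
    nlinarith [sq_nonneg (q * x + s - 1), sq_nonneg (q * x + s)]
  · have hdisc : discrim q (2 * s - 1) (Phi6 s / q) = -3 := by
      rw [discrim]
      linear_combination -4 * hquot
    refine irreducible_quadratic_of_discrim_neg (by omega) fun d h2 h1 h0 => ?_
    have hsq : d * d ∣ 3 := by
      rw [← dvd_neg, ← hdisc, discrim, sq, mul_assoc 4]
      exact dvd_sub (mul_dvd_mul h1 h1) ((mul_dvd_mul h2 h0).mul_left 4)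
    exact Int.prime_three.squarefree d hsq
  · have hexp : ((C q * X + C s) ^ 2 + 1 : ℤ[X]) =
        C (q ^ 2) * X ^ 2 + C (2 * q * s) * X + C (s ^ 2 + 1) := by
      simp only [C_mul, C_add, C_pow, map_ofNat, C_1]
      ring
    rw [hexp]
    refine irreducible_quadratic_of_discrim_neg ?_ fun d h2 _ h0 => ?_
    · rw [discrim]
      nlinarith [sq_pos_of_ne_zero hq.ne_zero]
    · have hcop : IsCoprime (q ^ 2) (s ^ 2 + 1) := by
        refine IsCoprime.pow_left (hq.coprime_iff_not_dvd.2 fun hdiv => hq.not_isUnit ?_)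
        have hs : q ∣ s := by
          have := dvd_sub hdiv hdvd
          rwa [Phi6, show s ^ 2 + 1 - (s ^ 2 - s + 1) = s by ring] at this
        exact isUnit_of_dvd_one ((dvd_add_right (dvd_pow hs two_ne_zero)).1 hdiv)
      exact hcop.isUnit_of_dvd' h2 h0
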